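/- Fix θ > 0. There exists N₁ ∈ ℕ such that for all n ≥ N₁: the function k ↦ L_n(θ,k) on {1,…,n} has a unique maximizer u_n(θ), and u_n(θ) equals ⌊u_n*(θ)⌋ or ⌈u_n*(θ)⌉, where u_n*(θ) = θ log n − θψ(θ) − 1/2. -/

import Mathlib

open Real Filter

/-- The Ewens probability mass function with parameter `θ`. -/
noncomputable def ewensPMF (n : ℕ) (θ : ℝ) (k : ℕ) : ℝ :=
  θ ^ k * ((ascPochhammer ℕ n).coeff k : ℝ) / (ascPochhammer ℝ n).eval θ

/-- The digamma function `ψ(θ) = Γ′(θ)/Γ(θ)`, the derivative of `log ∘ Γ`. -/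
noncomputable def digamma (θ : ℝ) : ℝ := deriv (fun x => Real.log (Real.Gamma x)) θ

open Polynomial in
/-- The generating polynomial `∏ (1 + wᵢ X)` of the elementary symmetric functions of the
weights `wᵢ`, `i ∈ s`. -/
noncomputable def esymmGen (w : ℕ → ℝ) (s : Finset ℕ) : ℝ[X] :=
  ∏ i ∈ s, (1 + C (w i) * X)

namespace esymmGen

open Polynomial

variable {w : ℕ → ℝ} {s : Finset ℕ}

lemma coeff_zero (w : ℕ → ℝ) (s : Finset ℕ) : (esymmGen w s).coeff 0 = 1 := by
  simp [esymmGen, coeff_zero_eq_eval_zero, eval_prod]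

lemma coeff_insert {i : ℕ} (hi : i ∉ s) (k : ℕ) :
    (esymmGen w (insert i s)).coeff (k + 1)
      = (esymmGen w s).coeff (k + 1) + w i * (esymmGen w s).coeff k := by
  rw [esymmGen, Finset.prod_insert hi, add_mul, one_mul, coeff_add, mul_assoc, coeff_C_mul,
    coeff_X_mul, esymmGen]

lemma coeff_eq_erase {i : ℕ} (hi : i ∈ s) (k : ℕ) :
    (esymmGen w s).coeff (k + 1)
      = (esymmGen w (s.erase i)).coeff (k + 1) + w i * (esymmGen w (s.erase i)).coeff k := by
  conv_lhs => rw [← Finset.insert_erase hi]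
  exact coeff_insert (Finset.notMem_erase i s) k

lemma coeff_succ_eq_sum_erase (k : ℕ) :
    (k + 1) * (esymmGen w s).coeff (k + 1)
      = ∑ i ∈ s, w i * (esymmGen w (s.erase i)).coeff k := by
  have h : (derivative (esymmGen w s)).coeff k
      = ∑ i ∈ s, w i * (esymmGen w (s.erase i)).coeff k := by
    rw [esymmGen, derivative_prod_finset, finsetSum_coeff]
    refine Finset.sum_congr rfl fun i _ => ?_
    rw [derivative_add, derivative_one, zero_add, derivative_C_mul_X, mul_comm, coeff_C_mul]
    rfl
  rw [← h, coeff_derivative, mul_comm]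

lemma coeff_nonneg (hw : ∀ i ∈ s, 0 ≤ w i) (k : ℕ) : 0 ≤ (esymmGen w s).coeff k := by
  induction s using Finset.induction_on generalizing k with
  | empty => simp only [esymmGen, Finset.prod_empty, coeff_one]; split_ifs <;> norm_num
  | insert i s hi ih =>
    have ih' := ih fun j hj => hw j (Finset.mem_insert_of_mem hj)
    cases k with
    | zero => simp [coeff_zero]
    | succ k =>
      rw [coeff_insert hi]
      exact add_nonneg (ih' _) (mul_nonneg (hw i (Finset.mem_insert_self i s)) (ih' _))

lemma coeff_erase_nonneg (hw : ∀ i ∈ s, 0 ≤ w i) (i k : ℕ) :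
    0 ≤ (esymmGen w (s.erase i)).coeff k :=
  coeff_nonneg (fun j hj => hw j (Finset.mem_of_mem_erase hj)) k

lemma coeff_erase_le (hw : ∀ i ∈ s, 0 ≤ w i) {i : ℕ} (hi : i ∈ s) (k : ℕ) :
    (esymmGen w (s.erase i)).coeff k ≤ (esymmGen w s).coeff k := by
  cases k with
  | zero => simp [coeff_zero]
  | succ k =>
    rw [coeff_eq_erase hi]
    linarith [mul_nonneg (hw i hi) (coeff_erase_nonneg hw i k)]

lemma coeff_succ_le (hw : ∀ i ∈ s, 0 ≤ w i) (k : ℕ) :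
    (k + 1) * (esymmGen w s).coeff (k + 1) ≤ (∑ i ∈ s, w i) * (esymmGen w s).coeff k := by
  rw [coeff_succ_eq_sum_erase, Finset.sum_mul]
  exact Finset.sum_le_sum fun i hi =>
    mul_le_mul_of_nonneg_left (coeff_erase_le hw hi k) (hw i hi)

lemma le_coeff_add_two (hw : ∀ i ∈ s, 0 ≤ w i) (k : ℕ) :
    (∑ i ∈ s, w i) * (esymmGen w s).coeff (k + 1) - (∑ i ∈ s, w i ^ 2) * (esymmGen w s).coeff k
      ≤ (k + 2) * (esymmGen w s).coeff (k + 2) := by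
  have h := coeff_succ_eq_sum_erase (w := w) (s := s) (k + 1)
  push_cast at h
  rw [show (k + 2 : ℝ) = k + 1 + 1 by ring, h, Finset.sum_mul, Finset.sum_mul,
    ← Finset.sum_sub_distrib]
  refine Finset.sum_le_sum fun i hi => ?_
  rw [coeff_eq_erase hi k]
  nlinarith [mul_le_mul_of_nonneg_left (coeff_erase_le hw hi k) (sq_nonneg (w i))]

/-- A crude lower bound for the ratio of consecutive coefficients. -/
lemma le_coeff_succ (hw : ∀ i ∈ s, 0 ≤ w i) {D Q : ℝ} (hQ : ∑ i ∈ s, w i ^ 2 ≤ Q)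
    (hD : D + 2 * Q ≤ ∑ i ∈ s, w i) (k : ℕ) (hk : k + 1 ≤ 2 * D) :
    D * (esymmGen w s).coeff k ≤ (k + 1) * (esymmGen w s).coeff (k + 1) := by
  have hQ0 : 0 ≤ ∑ i ∈ s, w i ^ 2 := Finset.sum_nonneg fun i _ => sq_nonneg _
  induction k with
  | zero =>
    rw [coeff_succ_eq_sum_erase]
    simp only [coeff_zero, mul_one]
    linarith
  | succ k ih =>
    push_cast at hk ⊢
    have ih := ih (by linarith)
    have h2 := le_coeff_add_two hw k
    have e0 := coeff_nonneg hw k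
    have e1 := coeff_nonneg hw (k + 1)
    have h3 : (esymmGen w s).coeff k ≤ 2 * (esymmGen w s).coeff (k + 1) := by
      have hk0 : (0 : ℝ) ≤ k := k.cast_nonneg
      have h4 : (k + 1) * (esymmGen w s).coeff k
          ≤ (k + 1) * (2 * (esymmGen w s).coeff (k + 1)) := by nlinarith
      exact le_of_mul_le_mul_left h4 (by positivity)
    rw [show (k + 1 + 1 : ℝ) = k + 2 by ring]
    nlinarith

/-- If the ratios of consecutive coefficients are close to `1` after deletion of any one weight,
then `(k + 1) e_{k+1} / e_k` is close to `∑ wᵢ / (1 + wᵢ)`. -/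
lemma abs_coeff_succ_sub_le (hw : ∀ i ∈ s, 0 ≤ w i) {ε : ℝ} (hε : 0 ≤ ε) (k : ℕ)
    (h : ∀ i ∈ s, |(esymmGen w (s.erase i)).coeff k - (esymmGen w (s.erase i)).coeff (k + 1)|
      ≤ ε * (esymmGen w (s.erase i)).coeff (k + 1)) :
    |(k + 2) * (esymmGen w s).coeff (k + 2)
        - (∑ i ∈ s, w i / (1 + w i)) * (esymmGen w s).coeff (k + 1)|
      ≤ ε * (∑ i ∈ s, w i ^ 2) * (esymmGen w s).coeff (k + 1) := by
  have hs := coeff_succ_eq_sum_erase (w := w) (s := s) (k + 1)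
  push_cast at hs
  rw [show (k + 2 : ℝ) = k + 1 + 1 by ring, hs, Finset.sum_mul, Finset.mul_sum, Finset.sum_mul,
    ← Finset.sum_sub_distrib]
  refine (Finset.abs_sum_le_sum_abs _ _).trans (Finset.sum_le_sum fun i hi => ?_)
  have hwi := hw i hi
  have e1 := coeff_erase_nonneg hw i (k + 1)
  have e0 := coeff_erase_nonneg hw i k
  have hi' := h i hi
  have hle := coeff_erase_le hw hi (k + 1)
  have hc := coeff_eq_erase (w := w) hi k
  set a := (esymmGen w (s.erase i)).coeff k
  set b := (esymmGen w (s.erase i)).coeff (k + 1)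
  set c := (esymmGen w s).coeff (k + 1)
  have key : w i * b - w i / (1 + w i) * c = w i ^ 2 / (1 + w i) * (b - a) := by
    rw [hc]; field_simp; ring
  have hd : w i ^ 2 / (1 + w i) ≤ w i ^ 2 := div_le_self (sq_nonneg _) (by linarith)
  rw [key, abs_mul, abs_of_nonneg (by positivity), abs_sub_comm]
  have hεc : ε * b ≤ ε * c := mul_le_mul_of_nonneg_left hle hε
  calc w i ^ 2 / (1 + w i) * |a - b| ≤ w i ^ 2 * (ε * c) := by
        gcongr
        exact hi'.trans hεc
    _ = ε * w i ^ 2 * c := by ring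

lemma coeff_pos (hw : ∀ i ∈ s, 0 ≤ w i) {D Q : ℝ} (hD0 : 0 < D) (hQ : ∑ i ∈ s, w i ^ 2 ≤ Q)
    (hD : D + 2 * Q ≤ ∑ i ∈ s, w i) (k : ℕ) (hk : k ≤ 2 * D) :
    0 < (esymmGen w s).coeff k := by
  induction k with
  | zero => simp [coeff_zero]
  | succ k ih =>
    push_cast at hk
    have h := le_coeff_succ hw hQ hD k hk
    have := ih (by linarith)
    exact pos_of_mul_pos_right ((mul_pos hD0 this).trans_le h) (by positivity)

lemma abs_coeff_succ_sub_le_of_window (hw : ∀ i ∈ s, 0 ≤ w i) {M Q ε : ℝ}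
    (hM0 : 0 ≤ M) (hQ0 : 0 ≤ Q) (hM : ∀ i ∈ s, w i ≤ M) (hQ : ∑ i ∈ s, w i ^ 2 ≤ Q)
    (hε : 0 ≤ ε) (hW : 2 * M + 4 * Q + 2 ≤ ∑ i ∈ s, w i)
    (hWε : M + 2 * Q + 1 ≤ (∑ i ∈ s, w i - M - 2 * Q) * ε) (k : ℕ)
    (hk : k + 1 ≤ ∑ i ∈ s, w i) (hk' : ∑ i ∈ s, w i - 2 * Q ≤ k + 1) :
    |(k + 1) * (esymmGen w s).coeff (k + 1)
        - (∑ i ∈ s, w i / (1 + w i)) * (esymmGen w s).coeff k|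
      ≤ ε * Q * (esymmGen w s).coeff k := by
  obtain _ | j := k
  · simp only [CharP.cast_eq_zero, zero_add] at hk'
    linarith
  push_cast at hk hk' ⊢
  have key := abs_coeff_succ_sub_le hw hε j fun i hi => ?_
  · rw [show (j + 1 + 1 : ℝ) = j + 2 by ring]
    refine key.trans ?_
    have := coeff_nonneg hw (j + 1)
    gcongr
  have hw' : ∀ l ∈ s.erase i, 0 ≤ w l := fun l hl => hw l (Finset.mem_of_mem_erase hl)
  have hQ' : ∑ l ∈ s.erase i, w l ^ 2 ≤ Q :=
    (Finset.sum_le_sum_of_subset_of_nonneg (Finset.erase_subset i s)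
      fun l _ _ => sq_nonneg _).trans hQ
  have hW' := Finset.add_sum_erase s w hi
  have h1 := le_coeff_succ hw' (D := ∑ i ∈ s, w i - M - 2 * Q) hQ'
    (by linarith [hM i hi]) j (by linarith)
  have h2 := coeff_succ_le hw' j
  have e0 := coeff_nonneg hw' j
  have e1 := coeff_nonneg hw' (j + 1)
  have hwi := hw i hi
  set W := ∑ i ∈ s, w i
  set a := (esymmGen w (s.erase i)).coeff j
  set b := (esymmGen w (s.erase i)).coeff (j + 1)
  have hDpos : 0 < W - M - 2 * Q := by linarith
  have hWpos : 0 < W := by linarith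
  have hupper : a ≤ (1 + ε) * b := by
    refine le_of_mul_le_mul_left (h1.trans ?_) hDpos
    rw [← mul_assoc]
    refine mul_le_mul_of_nonneg_right ?_ e1
    linarith
  have hlower : (1 - ε) * b ≤ a := by
    refine le_of_mul_le_mul_left ?_ hWpos
    have h3 : (∑ l ∈ s.erase i, w l) * a ≤ W * a :=
      mul_le_mul_of_nonneg_right (by linarith) e0
    refine le_trans ?_ (h2.trans h3)
    rw [← mul_assoc]
    refine mul_le_mul_of_nonneg_right ?_ e1
    nlinarith [mul_nonneg (add_nonneg hM0 hQ0) hε, mul_nonneg hQ0 hε]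
  rw [abs_le]
  constructor <;> linarith

/-- The coefficients `e_k` of `∏ (1 + wᵢ X)` increase up to `∑ wᵢ / (1 + wᵢ) - 1 / 4` and decrease
from `∑ wᵢ / (1 + wᵢ) + 1 / 4` on, once `∑ wᵢ` is large in terms of bounds for `wᵢ` and
`∑ wᵢ ^ 2`. -/
theorem exists_coeff_lt {M Q : ℝ} (hM0 : 0 ≤ M) (hQ0 : 0 ≤ Q) :
    ∃ W₀ : ℝ, ∀ (w : ℕ → ℝ) (s : Finset ℕ), (∀ i ∈ s, 0 ≤ w i) → (∀ i ∈ s, w i ≤ M) →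
      ∑ i ∈ s, w i ^ 2 ≤ Q → W₀ ≤ ∑ i ∈ s, w i → ∀ k : ℕ,
        ((k + 1 : ℝ) ≤ ∑ i ∈ s, w i / (1 + w i) - 1 / 4 →
          (esymmGen w s).coeff k < (esymmGen w s).coeff (k + 1)) ∧
        (∑ i ∈ s, w i / (1 + w i) + 1 / 4 ≤ (k + 1 : ℝ) → 0 < (esymmGen w s).coeff (k + 1) →
          (esymmGen w s).coeff (k + 1) < (esymmGen w s).coeff k) := by
  refine ⟨M + 2 * Q + 8 * (Q + 1) * (M + 2 * Q + 1), fun w s hw hM hQ hW k => ?_⟩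
  have hμW : ∑ i ∈ s, w i / (1 + w i) ≤ ∑ i ∈ s, w i :=
    Finset.sum_le_sum fun i hi => div_le_self (hw i hi) (by linarith [hw i hi])
  have hWμ : ∑ i ∈ s, w i - Q ≤ ∑ i ∈ s, w i / (1 + w i) := by
    refine (sub_le_sub_left hQ _).trans ?_
    rw [← Finset.sum_sub_distrib]
    refine Finset.sum_le_sum fun i hi => ?_
    have := hw i hi
    rw [le_div_iff₀ (by linarith)]
    nlinarith [pow_nonneg this 3]
  have hwin := abs_coeff_succ_sub_le_of_window hw hM0 hQ0 hM hQ
    (ε := 1 / (8 * (Q + 1))) (by positivity) (by nlinarith [mul_nonneg hQ0 hM0])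
    (by rw [mul_one_div, le_div_iff₀ (by positivity)]; linarith) k
  have hεQ : 1 / (8 * (Q + 1)) * Q ≤ 1 / 8 := by
    rw [div_mul_eq_mul_div, div_le_div_iff₀ (by positivity) (by positivity)]
    linarith
  have hup := coeff_succ_le hw k
  have hdown := le_coeff_succ hw (D := ∑ i ∈ s, w i - 2 * Q) hQ (by linarith) k
  have hpos := coeff_pos hw (D := ∑ i ∈ s, w i - 2 * Q) (by nlinarith [mul_nonneg hQ0 hM0]) hQ
    (by linarith) k
  have hW2 : 4 * Q + 2 ≤ ∑ i ∈ s, w i := by nlinarith [mul_nonneg hQ0 hM0]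
  have e0 := coeff_nonneg hw k
  set W := ∑ i ∈ s, w i
  set μ := ∑ i ∈ s, w i / (1 + w i)
  set a := (esymmGen w s).coeff k
  set b := (esymmGen w s).coeff (k + 1)
  have hk1 : (0 : ℝ) < k + 1 := by positivity
  have hwin' : (k + 1 : ℝ) ≤ W → W - 2 * Q ≤ (k + 1 : ℝ) → |(k + 1) * b - μ * a| ≤ 1 / 8 * a :=
    fun h h' => (hwin h h').trans (mul_le_mul_of_nonneg_right hεQ e0)
  constructor
  · intro hk
    have ha : 0 < a := hpos (by linarith)
    refine lt_of_mul_lt_mul_left ?_ hk1.le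
    rcases lt_or_ge (k + 1 : ℝ) (W - 2 * Q) with h | h
    · exact (mul_lt_mul_of_pos_right h ha).trans_le (hdown (by linarith))
    · have := (abs_le.mp (hwin' (by linarith) h)).1
      nlinarith
  · intro hk hb
    have ha : 0 < a := by
      refine pos_of_mul_pos_right ((mul_pos hk1 hb).trans_le hup) (by linarith)
    refine lt_of_mul_lt_mul_left ?_ hk1.le
    rcases lt_or_ge W (k + 1 : ℝ) with h | h
    · exact hup.trans_lt (mul_lt_mul_of_pos_right h ha)
    · have := (abs_le.mp (hwin' h (by linarith))).2
      nlinarith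

end esymmGen

lemma differentiableAt_log_Gamma {x : ℝ} (hx : 0 < x) :
    DifferentiableAt ℝ (fun x => Real.log (Real.Gamma x)) x :=
  (Real.differentiableAt_Gamma fun m => by
    have : (0 : ℝ) ≤ m := m.cast_nonneg
    linarith).log (Real.Gamma_pos_of_pos hx).ne'

lemma log_Gamma_add_one {x : ℝ} (hx : 0 < x) :
    Real.log (Real.Gamma (x + 1)) = Real.log x + Real.log (Real.Gamma x) := by
  rw [Real.Gamma_add_one hx.ne', Real.log_mul hx.ne' (Real.Gamma_pos_of_pos hx).ne']

lemma digamma_add_one {x : ℝ} (hx : 0 < x) : digamma (x + 1) = digamma x + 1 / x := by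
  have h : (fun y => Real.log (Real.Gamma (y + 1)))
      =ᶠ[nhds x] fun y => Real.log y + Real.log (Real.Gamma y) := by
    filter_upwards [eventually_gt_nhds hx] with y hy using log_Gamma_add_one hy
  rw [digamma, digamma, ← deriv_comp_add_const (f := fun y => Real.log (Real.Gamma y)), h.deriv_eq,
    deriv_fun_add (Real.differentiableAt_log hx.ne') (differentiableAt_log_Gamma hx),
    Real.deriv_log, one_div, add_comm]

lemma digamma_le_log {x : ℝ} (hx : 0 < x) : digamma x ≤ Real.log x := by
  have h := Real.convexOn_log_Gamma.deriv_le_slope (x := x) (y := x + 1) hx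
    (show (0 : ℝ) < x + 1 by linarith) (by linarith) (differentiableAt_log_Gamma hx)
  rw [slope_def_field, Function.comp_apply, Function.comp_apply, log_Gamma_add_one hx] at h
  simpa [digamma, Function.comp_def] using h

lemma log_le_digamma_add_one {x : ℝ} (hx : 0 < x) : Real.log x ≤ digamma (x + 1) := by
  have hx1 : 0 < x + 1 := by linarith
  have h := Real.convexOn_log_Gamma.slope_le_deriv (x := x) (y := x + 1) hx hx1
    (by linarith) (differentiableAt_log_Gamma hx1)
  rw [slope_def_field, Function.comp_apply, Function.comp_apply, log_Gamma_add_one hx] at h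
  simpa [digamma, Function.comp_def] using h

lemma sum_one_div_add_eq_digamma_sub {θ : ℝ} (hθ : 0 < θ) (n : ℕ) :
    ∑ i ∈ Finset.range n, 1 / (θ + i) = digamma (θ + n) - digamma θ := by
  induction n with
  | zero => simp
  | succ n ih =>
    rw [Finset.sum_range_succ, ih, Nat.cast_succ, ← add_assoc, digamma_add_one (by positivity)]
    ring

lemma tendsto_sum_one_div_add_sub_log {θ : ℝ} (hθ : 0 < θ) :
    Tendsto (fun n : ℕ => ∑ i ∈ Finset.range n, 1 / (θ + i) - Real.log n) atTop
      (nhds (-digamma θ)) := by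
  have hlog : Tendsto (fun n : ℕ => Real.log (n + θ) - Real.log n) atTop (nhds 0) :=
    (Real.tendsto_log_comp_add_sub_log θ).comp tendsto_natCast_atTop_atTop
  have hinv : Tendsto (fun n : ℕ => 1 / ((n : ℝ) + θ)) atTop (nhds 0) := by
    simp only [one_div]
    exact (tendsto_atTop_add_const_right _ θ tendsto_natCast_atTop_atTop).inv_tendsto_atTop
  have hlow : Tendsto (fun n : ℕ => Real.log (n + θ) - Real.log n - 1 / ((n : ℝ) + θ) - digamma θ)
      atTop (nhds (-digamma θ)) := by
    simpa using (hlog.sub hinv).sub_const (digamma θ)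
  have hupp : Tendsto (fun n : ℕ => Real.log (n + θ) - Real.log n - digamma θ)
      atTop (nhds (-digamma θ)) := by
    simpa using hlog.sub_const (digamma θ)
  refine tendsto_of_tendsto_of_tendsto_of_le_of_le hlow hupp (fun n => ?_) (fun n => ?_)
  · have hx : 0 < (n : ℝ) + θ := by positivity
    have h := log_le_digamma_add_one hx
    rw [digamma_add_one hx] at h
    rw [sum_one_div_add_eq_digamma_sub hθ, add_comm θ]
    linarith
  · have h := digamma_le_log (x := n + θ) (by positivity)
    rw [sum_one_div_add_eq_digamma_sub hθ, add_comm θ]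
    linarith

lemma ascPochhammer_coeff_succ (n k : ℕ) :
    (ascPochhammer ℕ (n + 1)).coeff (k + 1)
      = (ascPochhammer ℕ n).coeff k + n * (ascPochhammer ℕ n).coeff (k + 1) := by
  rw [ascPochhammer_succ_right, mul_add, Polynomial.coeff_add, Polynomial.coeff_mul_X,
    Polynomial.coeff_mul_natCast, mul_comm, Nat.cast_id]

lemma ascPochhammer_coeff_le_factorial (n k : ℕ) : (ascPochhammer ℕ n).coeff k ≤ n.factorial := by
  induction n generalizing k with
  | zero =>
    rw [ascPochhammer_zero, Polynomial.coeff_one]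
    split_ifs <;> simp
  | succ n ih =>
    cases k with
    | zero =>
      rw [Polynomial.coeff_zero_eq_eval_zero, ascPochhammer_eval_zero]
      simp
    | succ k =>
      rw [ascPochhammer_coeff_succ, Nat.factorial_succ, add_mul, one_mul, add_comm]
      exact add_le_add (Nat.mul_le_mul_left n (ih _)) (ih _)

lemma ascPochhammer_coeff_pos {n k : ℕ} (hk : 0 < k) (hkn : k ≤ n) :
    0 < (ascPochhammer ℕ n).coeff k := by
  induction n, hkn using Nat.le_induction with
  | base =>
    have h := (monic_ascPochhammer ℕ k).coeff_natDegree
    rw [ascPochhammer_natDegree] at h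
    omega
  | succ n hn ih =>
    obtain ⟨k, rfl⟩ := Nat.exists_eq_add_of_lt hk
    rw [zero_add] at *
    rw [ascPochhammer_coeff_succ]
    have : 0 < n := by omega
    positivity

open Polynomial in
lemma pow_mul_coeff_prod_X_add (p m i : ℕ) :
    p ^ i * (∏ j ∈ Finset.range m, (X + C (p * j))).coeff i
      = p ^ m * (ascPochhammer ℕ m).coeff i := by
  induction m generalizing i with
  | zero =>
    rw [Finset.prod_range_zero, ascPochhammer_zero, coeff_one]
    split_ifs with h <;> simp [h]
  | succ m ih =>
    rw [Finset.prod_range_succ, mul_add, coeff_add, coeff_mul_C]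
    cases i with
    | zero =>
      have h := ih 0
      rw [ascPochhammer_succ_right, mul_add (ascPochhammer ℕ m), coeff_add, coeff_mul_natCast,
        coeff_mul_X_zero, coeff_mul_X_zero, Nat.cast_id]
      linear_combination p * m * h
    | succ i =>
      rw [coeff_mul_X, ascPochhammer_coeff_succ]
      linear_combination p * ih i + p * m * ih (i + 1)

open Polynomial in
/-- Splitting the factors `X + i`, `i < n`, according to whether `p ∣ i`. -/
lemma exists_ascPochhammer_eq_prod_mul {p : ℕ} (hp : p.Prime) (n : ℕ) :
    ∃ U : ℕ[X], ¬ p ∣ U.coeff 0 ∧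
      ascPochhammer ℕ n = (∏ j ∈ Finset.range ((n + p - 1) / p), (X + C (p * j))) * U := by
  have hp0 := hp.pos
  induction n with
  | zero =>
    refine ⟨1, by simpa using hp.one_lt.ne', ?_⟩
    rw [Nat.div_eq_of_lt (by omega)]
    simp
  | succ n ih =>
    obtain ⟨U, hU, h⟩ := ih
    have hdiv := Nat.succ_div (a := n + p - 1) (b := p)
    rw [show n + p - 1 + 1 = n + p by omega] at hdiv
    rw [show n + 1 + p - 1 = n + p by omega, hdiv, ascPochhammer_succ_right, h]
    by_cases hpn : p ∣ n
    · refine ⟨U, hU, ?_⟩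
      obtain ⟨m, rfl⟩ := hpn
      have hm : (p * m + p - 1) / p = m := by
        rw [Nat.add_sub_assoc hp0, Nat.mul_add_div hp0, Nat.div_eq_of_lt (by omega), add_zero]
      have hC : (C (p * m) : ℕ[X]) = (p * m : ℕ) := C_eq_natCast (R := ℕ) (p * m)
      rw [if_pos (by simp), hm, Finset.prod_range_succ, hC]
      ring
    · refine ⟨U * (X + C n), ?_, ?_⟩
      · rw [mul_coeff_zero, coeff_add, coeff_X_zero, coeff_C_zero, zero_add, hp.dvd_mul]
        tauto
      · rw [if_neg (by simpa using hpn), add_zero, mul_assoc]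
        simp

/-- A tie between neighbouring Stirling numbers forces divisibility of a much smaller Stirling
number by every prime that is not too large. -/
lemma dvd_ascPochhammer_coeff_of_tie {p : ℕ} (hp : p.Prime) {a b n k : ℕ} (ha : ¬ p ∣ a)
    (hk : k + 1 ≤ (n + p - 1) / p)
    (h : b * (ascPochhammer ℕ n).coeff k = a * (ascPochhammer ℕ n).coeff (k + 1)) :
    p ∣ (ascPochhammer ℕ ((n + p - 1) / p)).coeff (k + 1) := by
  obtain ⟨U, hU, hA⟩ := exists_ascPochhammer_eq_prod_mul hp n
  set M := (n + p - 1) / p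
  have hB : ∀ i ≤ M, (∏ j ∈ Finset.range M, (Polynomial.X + Polynomial.C (p * j))).coeff i
      = p ^ (M - i) * (ascPochhammer ℕ M).coeff i := by
    intro i hi
    have h := pow_mul_coeff_prod_X_add p M i
    rw [← Nat.add_sub_of_le hi, pow_add, Nat.add_sub_of_le hi, mul_assoc] at h
    exact Nat.eq_of_mul_eq_mul_left (pow_pos hp.pos i) h
  set B := ∏ j ∈ Finset.range M, (Polynomial.X + Polynomial.C (p * j))
  have hBdvd : ∀ i ≤ k, p ^ (M - k) ∣ B.coeff i := fun i hi => by
    rw [hB i (by omega)]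
    exact (pow_dvd_pow p (by omega)).mul_right _
  have hk0 : p ^ (M - k) ∣ (ascPochhammer ℕ n).coeff k := by
    rw [hA, Polynomial.coeff_mul]
    refine Finset.dvd_sum fun x hx => (hBdvd _ ?_).mul_right _
    have := Finset.HasAntidiagonal.mem_antidiagonal.1 hx
    omega
  have hk1 : p ^ (M - k) ∣ (ascPochhammer ℕ n).coeff (k + 1) := by
    refine Nat.Coprime.dvd_of_dvd_mul_left (m := a) ?_ (h ▸ hk0.mul_left b)
    exact Nat.Coprime.pow_left _ ((Nat.Prime.coprime_iff_not_dvd hp).2 ha)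
  rw [hA, Polynomial.coeff_mul, Finset.Nat.sum_antidiagonal_eq_sum_range_succ_mk,
    Finset.sum_range_succ, Nat.dvd_add_right, Nat.sub_self, hB _ hk] at hk1
  · rw [show M - k = M - (k + 1) + 1 by omega, pow_succ, mul_assoc] at hk1
    have := Nat.dvd_of_mul_dvd_mul_left (pow_pos hp.pos _) hk1
    exact (hp.dvd_mul.1 this).resolve_right hU
  · refine Finset.dvd_sum fun i hi => (hBdvd i ?_).mul_right _
    have := Finset.mem_range.1 hi
    omega

lemma theta_le_of_tie {a b n k X Y T : ℕ} (haY : a ≤ Y) (ha : 0 < a) (hX : X * k < n)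
    (hT : n ≤ (Y + 1) * T) (hT0 : 0 < T)
    (h : b * (ascPochhammer ℕ n).coeff k = a * (ascPochhammer ℕ n).coeff (k + 1)) :
    Chebyshev.theta X ≤ Y * Real.log 4 + T ^ 2 * Real.log T := by
  set P := ∏ M ∈ Finset.Icc (k + 1) T, (ascPochhammer ℕ M).coeff (k + 1)
  have hP0 : 0 < P := Finset.prod_pos fun M hM =>
    ascPochhammer_coeff_pos k.succ_pos (Finset.mem_Icc.1 hM).1
  have hPle : P ≤ T ^ T ^ 2 := by
    calc P ≤ ∏ M ∈ Finset.Icc (k + 1) T, T ^ T := Finset.prod_le_prod' fun M hM =>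
          (ascPochhammer_coeff_le_factorial M _).trans <|
            (Nat.factorial_le (Finset.mem_Icc.1 hM).2).trans T.factorial_le_pow
      _ = (T ^ T) ^ (T - k) := by
          rw [Finset.prod_const, Nat.card_Icc]
          congr 1
          omega
      _ ≤ (T ^ T) ^ T := Nat.pow_le_pow_right (by positivity) (by omega)
      _ = T ^ T ^ 2 := by rw [← pow_mul, sq]
  have hdvd : primorial X ∣ primorial Y * P := by
    rw [primorial_eq_prod_primesLE X]
    refine Finset.prod_primes_dvd _ (fun p hp => ?_) (fun p hp => ?_)
    · exact (Nat.prime_of_mem_primesLE hp).prime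
    · have hpp := Nat.prime_of_mem_primesLE hp
      have hpX : p ≤ X := Nat.le_of_mem_primesLE hp
      have hp0 := hpp.pos
      rcases le_or_gt p Y with hpY | hpY
      · exact (hpp.dvd_primorial_iff.2 hpY).mul_right _
      · have hk : k + 1 ≤ (n + p - 1) / p := by
          rw [Nat.le_div_iff_mul_le hp0]
          have : k * p ≤ X * k := by rw [mul_comm]; exact Nat.mul_le_mul_right k hpX
          rw [add_mul]
          omega
        have hMT : (n + p - 1) / p ≤ T := by
          rw [← Nat.lt_succ_iff, Nat.div_lt_iff_lt_mul hp0]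
          have : (Y + 1) * T ≤ T * p := by rw [mul_comm]; exact Nat.mul_le_mul_left T hpY
          rw [Nat.succ_mul]
          omega
        have := dvd_ascPochhammer_coeff_of_tie hpp
          (fun hd => absurd (Nat.le_of_dvd ha hd) (by omega)) hk h
        exact (this.trans (Finset.dvd_prod_of_mem
          (fun M => (ascPochhammer ℕ M).coeff (k + 1)) (Finset.mem_Icc.2 ⟨hk, hMT⟩))).mul_left _
  have hle : primorial X ≤ 4 ^ Y * T ^ T ^ 2 :=
    (Nat.le_of_dvd (Nat.mul_pos (primorial_pos Y) hP0) hdvd).trans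
      (Nat.mul_le_mul (primorial_le_four_pow Y) hPle)
  rw [Chebyshev.theta_eq_log_primorial, Nat.floor_natCast]
  have hT0' : (T : ℝ) ≠ 0 := by positivity
  calc Real.log (primorial X) ≤ Real.log ((4 : ℝ) ^ Y * (T : ℝ) ^ T ^ 2) := by
        refine Real.log_le_log (by exact_mod_cast primorial_pos X) ?_
        exact_mod_cast hle
    _ = Y * Real.log 4 + T ^ 2 * Real.log T := by
        rw [Real.log_mul (by positivity) (by positivity), Real.log_pow, Real.log_pow]
        push_cast
        rfl

lemma coeff_ne_of_lt_root {a b n k t : ℕ} (ha : 0 < a) (hat : a ≤ t) (ht : 1000 ≤ t)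
    (hkt : k < t) (htn : t ^ 10 ≤ n) (hnt : n ≤ (t + 1) ^ 10) :
    b * (ascPochhammer ℕ n).coeff k ≠ a * (ascPochhammer ℕ n).coeff (k + 1) := by
  intro h
  have hX : t ^ 9 * k < n := by
    refine lt_of_lt_of_le ?_ htn
    rw [pow_succ t 9]
    exact Nat.mul_lt_mul_of_pos_left hkt (by positivity)
  have hY : a ≤ (t + 1) ^ 8 := hat.trans (t.le_succ.trans (Nat.le_self_pow (by norm_num) _))
  have hT : n ≤ ((t + 1) ^ 8 + 1) * (t + 1) ^ 2 :=
    hnt.trans (by rw [pow_add (t + 1) 8 2]; exact Nat.mul_le_mul_right _ (Nat.le_succ _))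
  have h1 := theta_le_of_tie hY ha hX hT (by positivity) h
  have h2 := Chebyshev.theta_ge (t ^ 9)
  push_cast at h1 h2
  have hx : (1000 : ℝ) ≤ t := by exact_mod_cast ht
  generalize (t : ℝ) = x at *
  have hlog4 : Real.log 4 = 2 * Real.log 2 := by
    rw [show (4 : ℝ) = 2 ^ 2 by norm_num, Real.log_pow]; norm_num
  have l2 := Real.log_two_gt_d9
  have l2' := Real.log_two_lt_d9
  have hx0 : 0 < x := by linarith
  have hlx : Real.log (x + 1) ≤ x := by
    have := Real.log_le_sub_one_of_pos (show 0 < x + 1 by linarith)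
    linarith
  have hlx' : Real.log x ≤ x := (Real.log_le_log hx0 (by linarith)).trans hlx
  have hlx0 : 0 ≤ Real.log x := Real.log_nonneg (by linarith)
  have e1 : Real.log (x ^ 9 + 1) ≤ 9 * x := by
    calc Real.log (x ^ 9 + 1) ≤ Real.log ((x + 1) ^ 9) := by
          refine Real.log_le_log (by positivity) ?_
          have := pow_add_pow_le hx0.le zero_le_one (n := 9) (by norm_num)
          simpa using this
      _ = 9 * Real.log (x + 1) := by rw [Real.log_pow]; norm_num
      _ ≤ 9 * x := by linarith
  have e2 : √(x ^ 9) ≤ x ^ 5 := by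
    rw [Real.sqrt_le_left (by positivity), ← pow_mul]
    exact pow_le_pow_right₀ (by linarith) (by norm_num)
  have e3 : 2 * √(x ^ 9) * Real.log (x ^ 9) ≤ 18 * x ^ 6 := by
    rw [Real.log_pow]
    calc 2 * √(x ^ 9) * ((9 : ℕ) * Real.log x) ≤ 2 * x ^ 5 * ((9 : ℕ) * x) := by gcongr
      _ = 18 * x ^ 6 := by push_cast; ring
  have e4 : ((x + 1) ^ 2) ^ 2 * Real.log ((x + 1) ^ 2) ≤ 32 * x ^ 5 := by
    rw [Real.log_pow, ← pow_mul]
    calc (x + 1) ^ (2 * 2) * ((2 : ℕ) * Real.log (x + 1)) ≤ (2 * x) ^ (2 * 2) * ((2 : ℕ) * x) := by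
          have : 0 ≤ Real.log (x + 1) := Real.log_nonneg (by linarith)
          gcongr
          linarith
      _ = 32 * x ^ 5 := by push_cast; ring
  have e5 : (x + 1) ^ 8 * Real.log 4 ≤ 2 ^ 8 * x ^ 8 * (14 / 10) := by
    rw [hlog4, ← mul_pow]
    gcongr
    · linarith
    · linarith
  have e6 : x ^ 9 * (69 / 100) ≤ x ^ 9 * Real.log 2 := by
    gcongr
    linarith
  have f9 : 1000 * x ^ 8 ≤ x ^ 9 := by rw [pow_succ x 8, mul_comm]; gcongr
  have f6 : x ^ 6 ≤ x ^ 8 := pow_le_pow_right₀ (by linarith) (by norm_num)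
  have f5 : x ^ 5 ≤ x ^ 8 := pow_le_pow_right₀ (by linarith) (by norm_num)
  have f1 : x ≤ x ^ 8 := le_self_pow₀ (by linarith) (by norm_num)
  have f0 : 0 < x ^ 8 := by positivity
  linarith

lemma coeff_mul_pow_eq_esymmGen (θ : ℝ) (m k : ℕ) :
    θ ^ (k + 1) * ((ascPochhammer ℕ (m + 1)).coeff (k + 1) : ℝ)
      = θ * m.factorial * (esymmGen (fun i => θ / i) (Finset.Ico 1 (m + 1))).coeff k := by
  induction m generalizing k with
  | zero => cases k <;> simp [esymmGen, Polynomial.coeff_X, Polynomial.coeff_one]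
  | succ m ih =>
    rw [ascPochhammer_coeff_succ, ← Finset.insert_Ico_right_eq_Ico_add_one (by omega)]
    have hm : ((m + 1 : ℕ) : ℝ) ≠ 0 := by positivity
    cases k with
    | zero =>
      have h := ih 0
      rw [esymmGen.coeff_zero] at h ⊢
      have h0 : (ascPochhammer ℕ (m + 1)).coeff 0 = 0 := by
        rw [Polynomial.coeff_zero_eq_eval_zero, ascPochhammer_eval_zero]
        simp
      rw [h0, Nat.factorial_succ]
      push_cast at h ⊢
      linear_combination (m + 1 : ℝ) * h
    | succ k =>
      rw [esymmGen.coeff_insert (by simp), Nat.factorial_succ]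
      have h0 := ih k
      have h1 := ih (k + 1)
      push_cast at h0 h1 hm ⊢
      field_simp
      linear_combination θ * h0 + (m + 1 : ℝ) * h1

lemma exists_ewensPMF_eq {θ : ℝ} (hθ : 0 < θ) {n : ℕ} (hn : 1 ≤ n) :
    ∃ c > 0, ∀ k, ewensPMF n θ (k + 1)
      = c * (esymmGen (fun i => θ / i) (Finset.Ico 1 n)).coeff k := by
  obtain ⟨m, rfl⟩ := Nat.exists_eq_add_of_le' hn
  have he := ascPochhammer_pos (m + 1) θ hθ
  refine ⟨θ * m.factorial / (ascPochhammer ℝ (m + 1)).eval θ, by positivity, fun k => ?_⟩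
  rw [ewensPMF, coeff_mul_pow_eq_esymmGen]
  ring

lemma tendsto_sum_weights {θ : ℝ} (hθ : 0 < θ) :
    Tendsto (fun n : ℕ => ∑ i ∈ Finset.Ico 1 n, (θ / i) / (1 + θ / i)
      - (θ * Real.log n - θ * digamma θ - 1)) atTop (nhds 0) := by
  have h := (tendsto_sum_one_div_add_sub_log hθ).const_mul θ
  have h' := h.add_const (θ * digamma θ)
  rw [mul_neg, neg_add_cancel] at h'
  refine h'.congr' ?_
  filter_upwards [eventually_ge_atTop 1] with n hn
  have hsum : ∑ i ∈ Finset.Ico 1 n, (θ / i) / (1 + θ / i)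
      = θ * ∑ i ∈ Finset.range n, 1 / (θ + i) - 1 := by
    rw [Finset.range_eq_Ico, Finset.sum_eq_sum_Ico_succ_bot hn, mul_add, Finset.mul_sum]
    have : θ * (1 / (θ + (0 : ℕ))) = 1 := by
      rw [Nat.cast_zero, add_zero, mul_one_div_cancel hθ.ne']
    rw [this, add_sub_cancel_left]
    refine Finset.sum_congr rfl fun i hi => ?_
    have hi : (0 : ℝ) < i := by exact_mod_cast (Finset.mem_Ico.1 hi).1
    field_simp
    ring
  rw [hsum]
  ring

lemma tendsto_mode_center {θ : ℝ} (hθ : 0 < θ) (c : ℝ) :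
    Tendsto (fun n : ℕ => θ * Real.log n - θ * digamma θ - c) atTop atTop := by
  have h := (Real.tendsto_log_atTop.comp tendsto_natCast_atTop_atTop).const_mul_atTop hθ
  simp only [sub_eq_add_neg]
  exact tendsto_atTop_add_const_right _ _ (tendsto_atTop_add_const_right _ _ h)

lemma eventually_ewensPMF_lt {θ : ℝ} (hθ : 0 < θ) :
    ∀ᶠ n : ℕ in atTop, ∀ k : ℕ, 1 ≤ k →
      ((k + 1 : ℝ) ≤ θ * Real.log n - θ * digamma θ - 1 / 2 →
        ewensPMF n θ k < ewensPMF n θ (k + 1)) ∧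
      (θ * Real.log n - θ * digamma θ - 1 / 2 ≤ k → 0 < ewensPMF n θ (k + 1) →
        ewensPMF n θ (k + 1) < ewensPMF n θ k) := by
  have hsummable : Summable fun i : ℕ => (θ / i) ^ 2 := by
    simp only [div_pow]
    exact (Real.summable_one_div_nat_pow.2 one_lt_two).mul_left (θ ^ 2) |>.congr
      fun i => by rw [mul_one_div]
  obtain ⟨W₀, hW₀⟩ := esymmGen.exists_coeff_lt hθ.le
    (tsum_nonneg fun i => sq_nonneg _ : 0 ≤ ∑' i : ℕ, (θ / i) ^ 2)
  have hμ := (tendsto_sum_weights hθ).eventually (Metric.ball_mem_nhds 0 (ε := 1 / 4) (by norm_num))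
  filter_upwards [hμ, (tendsto_mode_center hθ 1).eventually_ge_atTop (W₀ + 1),
    eventually_ge_atTop 1] with n hμ hW hn k hk
  rw [Real.dist_eq, sub_zero, abs_lt] at hμ
  have hnonneg : ∀ i : ℕ, 0 ≤ θ / i := fun i => by positivity
  have hle : ∑ i ∈ Finset.Ico 1 n, (θ / i) / (1 + θ / i) ≤ ∑ i ∈ Finset.Ico 1 n, θ / i :=
    Finset.sum_le_sum fun i _ => div_le_self (hnonneg i) (by linarith [hnonneg i])
  obtain ⟨j, rfl⟩ := Nat.exists_eq_add_of_le' hk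
  obtain ⟨c, hc, hL⟩ := exists_ewensPMF_eq hθ hn
  obtain ⟨hup, hdown⟩ := hW₀ (fun i => θ / i) (Finset.Ico 1 n) (fun i _ => hnonneg i)
    (fun i hi => div_le_self hθ.le (by exact_mod_cast (Finset.mem_Ico.1 hi).1))
    (hsummable.sum_le_tsum _ fun i _ => sq_nonneg _) (by linarith) j
  push_cast
  rw [hL, hL]
  refine ⟨fun h => mul_lt_mul_of_pos_left (hup (by linarith)) hc, fun h h' => ?_⟩
  exact mul_lt_mul_of_pos_left (hdown (by linarith) (pos_of_mul_pos_right h' hc.le)) hc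

lemma eventually_mode_center_lt_root (θ : ℝ) :
    ∀ᶠ n : ℕ in atTop, θ * Real.log n - θ * digamma θ - 1 / 2 < ⌊(n : ℝ) ^ (1 / 10 : ℝ)⌋₊ := by
  have hlog : (fun n : ℕ => Real.log n) =o[atTop] fun n : ℕ => (n : ℝ) ^ (1 / 10 : ℝ) :=
    (isLittleO_log_rpow_atTop (by norm_num)).comp_tendsto tendsto_natCast_atTop_atTop
  have hroot : Tendsto (fun n : ℕ => (n : ℝ) ^ (1 / 10 : ℝ)) atTop atTop :=
    (tendsto_rpow_atTop (by norm_num)).comp tendsto_natCast_atTop_atTop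
  filter_upwards [(hlog.const_mul_left θ).bound (show (0 : ℝ) < 1 / 2 by norm_num),
    hroot.eventually_ge_atTop (2 * (1 - θ * digamma θ))] with n h1 h2
  rw [Real.norm_eq_abs, Real.norm_of_nonneg (by positivity)] at h1
  have := le_abs_self (θ * Real.log n)
  have := Nat.lt_floor_add_one ((n : ℝ) ^ (1 / 10 : ℝ))
  linarith

lemma eventually_ewensPMF_ne {θ : ℝ} (hθ : 0 < θ) :
    ∀ᶠ n : ℕ in atTop, ∀ k : ℕ, (k : ℝ) ≤ θ * Real.log n - θ * digamma θ - 1 / 2 →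
      0 < ewensPMF n θ k → ewensPMF n θ k ≠ ewensPMF n θ (k + 1) := by
  have htie : ∀ n k : ℕ, 0 < ewensPMF n θ k → ewensPMF n θ k = ewensPMF n θ (k + 1) →
      0 < (ascPochhammer ℕ n).coeff k ∧
      ((ascPochhammer ℕ n).coeff k : ℝ) = θ * (ascPochhammer ℕ n).coeff (k + 1) := by
    intro n k h0 h
    have he := ascPochhammer_pos n θ hθ
    constructor
    · rw [Nat.pos_iff_ne_zero]
      intro hz
      simp [ewensPMF, hz] at h0
    · rw [ewensPMF, ewensPMF, div_left_inj' he.ne', pow_succ, mul_assoc] at h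
      exact mul_left_cancel₀ (by positivity) h
  by_cases hrat : ∃ a b : ℕ, 0 < a ∧ 0 < b ∧ b * θ = a
  · obtain ⟨a, b, ha, hb, hab⟩ := hrat
    have hroot : Tendsto (fun n : ℕ => ⌊(n : ℝ) ^ (1 / 10 : ℝ)⌋₊) atTop atTop :=
      tendsto_nat_floor_atTop.comp
        ((tendsto_rpow_atTop (by norm_num)).comp tendsto_natCast_atTop_atTop)
    filter_upwards [eventually_mode_center_lt_root θ, hroot.eventually_ge_atTop a,
      hroot.eventually_ge_atTop 1000] with n hlt hat ht k hk h0 h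
    obtain ⟨-, hs⟩ := htie n k h0 h
    have hn10 : ((n : ℝ) ^ (1 / 10 : ℝ)) ^ 10 = n := by
      rw [← Real.rpow_natCast, ← Real.rpow_mul n.cast_nonneg]
      norm_num
    refine coeff_ne_of_lt_root (b := b) (k := k) ha hat ht ?_ ?_ ?_ ?_ (n := n)
    · exact_mod_cast hk.trans_lt hlt
    · have h := pow_le_pow_left₀ (Nat.cast_nonneg _)
        (Nat.floor_le (show 0 ≤ (n : ℝ) ^ (1 / 10 : ℝ) by positivity)) 10
      rw [hn10] at h
      exact_mod_cast h
    · have h := pow_le_pow_left₀ (show 0 ≤ (n : ℝ) ^ (1 / 10 : ℝ) by positivity)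
        (Nat.lt_floor_add_one _).le 10
      rw [hn10] at h
      exact_mod_cast h
    · have : (b : ℝ) * (ascPochhammer ℕ n).coeff k = a * (ascPochhammer ℕ n).coeff (k + 1) := by
        rw [hs, ← hab, mul_assoc]
      exact_mod_cast this
  · refine Eventually.of_forall fun n k _ h0 h => hrat ?_
    obtain ⟨hpos, hs⟩ := htie n k h0 h
    refine ⟨_, (ascPochhammer ℕ n).coeff (k + 1), hpos, Nat.pos_of_ne_zero fun hz => ?_, ?_⟩
    · rw [hz, Nat.cast_zero, mul_zero, Nat.cast_eq_zero] at hs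
      omega
    · rw [hs, mul_comm]

lemma ewensPMF_eq_zero_of_lt (θ : ℝ) {n k : ℕ} (h : n < k) : ewensPMF n θ k = 0 := by
  rw [ewensPMF, Polynomial.coeff_eq_zero_of_natDegree_lt (by rwa [ascPochhammer_natDegree])]
  simp

/-- For large `n` the Ewens distribution has a unique mode, equal to the floor or the
ceiling of `u_n*(θ) = θ log n − θψ(θ) − 1/2`. -/
theorem ewens_mode_unique (θ : ℝ) (hθ : 0 < θ) :
    ∃ N₁ : ℕ, ∀ n ≥ N₁, ∃ u ∈ Finset.Icc 1 n,
      (∀ k ∈ Finset.Icc 1 n, k ≠ u → ewensPMF n θ k < ewensPMF n θ u) ∧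
      ((u : ℤ) = ⌊θ * Real.log n - θ * digamma θ - 1 / 2⌋ ∨
        (u : ℤ) = ⌈θ * Real.log n - θ * digamma θ - 1 / 2⌉) := by
  have hmain := (eventually_ewensPMF_lt hθ).and ((eventually_ewensPMF_ne hθ).and
    (((tendsto_mode_center hθ (1 / 2)).eventually_ge_atTop 1).and (eventually_ge_atTop 1)))
  obtain ⟨N, hN⟩ := eventually_atTop.1 hmain
  refine ⟨N, fun n hn => ?_⟩
  obtain ⟨hlt, hne, hc1, hn1⟩ := hN n hn
  set c := θ * Real.log n - θ * digamma θ - 1 / 2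
  obtain ⟨u, hu, hmax⟩ := Finset.exists_max_image (Finset.Icc 1 n) (ewensPMF n θ)
    ⟨1, Finset.mem_Icc.2 ⟨le_rfl, hn1⟩⟩
  have hupos : 0 < ewensPMF n θ u := by
    refine lt_of_lt_of_le ?_ (hmax 1 (Finset.mem_Icc.2 ⟨le_rfl, hn1⟩))
    obtain ⟨d, hd, hL⟩ := exists_ewensPMF_eq hθ hn1
    rw [← zero_add 1, hL, esymmGen.coeff_zero, mul_one]
    exact hd
  have hloc : ∀ v ∈ Finset.Icc 1 n, ewensPMF n θ v = ewensPMF n θ u → c - 1 < v ∧ v < c + 1 := by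
    intro v hv hvu
    obtain ⟨hv1, hvn⟩ := Finset.mem_Icc.1 hv
    constructor
    · by_contra! h
      have hlt' := (hlt v hv1).1 (by linarith)
      rcases le_or_gt (v + 1) n with h' | h'
      · exact absurd (hmax _ (Finset.mem_Icc.2 ⟨by omega, h'⟩)) (by linarith)
      · rw [ewensPMF_eq_zero_of_lt θ h'] at hlt'
        linarith
    · by_contra! h
      obtain ⟨k, rfl⟩ := Nat.exists_eq_add_of_le' hv1
      push_cast at h
      have hk : 1 ≤ k := by
        have : (1 : ℝ) ≤ k := by linarith
        exact_mod_cast this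
      have := (hlt k hk).2 (by linarith) (hvu ▸ hupos)
      exact absurd (hmax k (Finset.mem_Icc.2 ⟨hk, by omega⟩)) (by linarith)
  have hno : ∀ v, v ∈ Finset.Icc 1 n → v + 1 ∈ Finset.Icc 1 n → ewensPMF n θ v = ewensPMF n θ u →
      ewensPMF n θ (v + 1) ≠ ewensPMF n θ u := by
    intro v hv hv' h h'
    have := (hloc _ hv' h').2
    push_cast at this
    exact hne v (by linarith) (h ▸ hupos) (h.trans h'.symm)
  refine ⟨u, hu, fun k hk hku => lt_of_le_of_ne (hmax k hk) fun heq => ?_, ?_⟩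
  · have hk' := hloc k hk heq
    have hu' := hloc u hu rfl
    have h1 : k < u + 2 := by
      have : (k : ℝ) < u + 2 := by linarith
      exact_mod_cast this
    have h2 : u < k + 2 := by
      have : (u : ℝ) < k + 2 := by linarith
      exact_mod_cast this
    rcases lt_or_gt_of_ne hku with h | h
    · obtain rfl : u = k + 1 := by omega
      exact hno k hk hu heq rfl
    · obtain rfl : k = u + 1 := by omega
      exact hno u hu hk rfl heq
  · have hu' := hloc u hu rfl
    rcases le_or_gt (u : ℝ) c with h | h
    · left
      symm
      rw [Int.floor_eq_iff]
      push_cast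
      exact ⟨h, by linarith⟩
    · right
      symm
      rw [Int.ceil_eq_iff]
      push_cast
      exact ⟨by linarith, h.le⟩
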